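/- Let f = Σ_a c_a X^a ∈ ℘(k[X]) where ℘(g)=g^p−g. Fix a₀ ∈ ℕ not divisible by p and let I_{a₀} = {a₀ p^n : n ∈ ℕ}. Then the polynomial f_{a₀}(X) := Σ_{a ∈ I_{a₀}} c_a X^a also lies in ℘(k[X]); in particular, if f_{a₀} is nonzero then p divides its degree. -/

import Mathlib

open Polynomial

theorem coeff_pow_char_aux {k : Type*} [Field k] {p : ℕ} [Fact p.Prime] [CharP k p]
    (g : Polynomial k) (a : ℕ) :
    (g ^ p).coeff a = if p ∣ a then (g.coeff (a / p)) ^ p else 0 := by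
  have hp : 0 < p := (Fact.out : p.Prime).pos
  rw [← Polynomial.map_frobenius_expand, Polynomial.coeff_map, Polynomial.coeff_expand hp]
  split_ifs
  · simp [frobenius_def]
  · simp

/-- Let `f = ℘ g = g ^ p - g` and fix `a₀` prime to `p`. The polynomial `f_{a₀}` obtained
from `f` by keeping exactly the monomials whose exponent lies in `{a₀ p ^ m : m ∈ ℕ}`
also lies in `℘(k[X])`; in particular, if `f_{a₀} ≠ 0` then `p` divides its degree. -/
theorem isolate_orbit_mem_wp_range
    {k : Type*} [Field k] {p : ℕ} [Fact p.Prime] (hch : CharP k p)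
    (f g : Polynomial k) (hf : f = g ^ p - g)
    (a₀ : ℕ) (ha₀ : ¬ p ∣ a₀)
    (fa : Polynomial k)
    (h1 : ∀ a : ℕ, (∃ m : ℕ, a = a₀ * p ^ m) → fa.coeff a = f.coeff a)
    (h2 : ∀ a : ℕ, (¬ ∃ m : ℕ, a = a₀ * p ^ m) → fa.coeff a = 0) :
    (∃ h : Polynomial k, fa = h ^ p - h) ∧ (fa ≠ 0 → p ∣ fa.natDegree) := by
  classical
  have hpp : p.Prime := Fact.out
  have hp : 0 < p := hpp.pos
  have key : ∃ h : Polynomial k, fa = h ^ p - h := by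
    let h : Polynomial k :=
      ∑ i ∈ g.support.filter (fun a => ∃ m : ℕ, a = a₀ * p ^ m), monomial i (g.coeff i)
    have hc : ∀ a, h.coeff a = if (∃ m : ℕ, a = a₀ * p ^ m) then g.coeff a else 0 := by
      intro a
      simp only [h, finset_sum_coeff, coeff_monomial, Finset.sum_ite_eq', Finset.mem_filter,
        mem_support_iff]
      by_cases h0 : g.coeff a = 0 <;> simp [h0]
    refine ⟨h, ?_⟩
    ext a
    rw [coeff_sub, coeff_pow_char_aux, hc, hc]
    by_cases ha : ∃ m : ℕ, a = a₀ * p ^ m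
    · rw [h1 a ha, hf, coeff_sub, coeff_pow_char_aux, if_pos ha]
      by_cases hd : p ∣ a
      · have : ∃ m : ℕ, a / p = a₀ * p ^ m := by
          obtain ⟨m, rfl⟩ := ha
          cases m with
          | zero => simp at hd; exact absurd hd ha₀
          | succ m => exact ⟨m, by rw [pow_succ, ← mul_assoc, Nat.mul_div_cancel _ hp]⟩
        simp only [if_pos hd, if_pos this]
      · simp only [if_neg hd]
    · rw [h2 a ha, if_neg ha]
      by_cases hd : p ∣ a
      · have : ¬ ∃ m : ℕ, a / p = a₀ * p ^ m := by
          rintro ⟨m, hm⟩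
          exact ha ⟨m + 1, by rw [pow_succ, ← mul_assoc, ← hm, Nat.div_mul_cancel hd]⟩
        simp [if_neg this, hp.ne']
      · simp [if_neg hd]
  refine ⟨key, fun _ => ?_⟩
  obtain ⟨h, rfl⟩ := key
  by_cases hd : h.natDegree = 0
  · rw [eq_C_of_natDegree_eq_zero hd, ← C_pow, ← C_sub, natDegree_C]
    exact dvd_zero _
  · have : h.natDegree < (h ^ p).natDegree := by
      rw [natDegree_pow]
      have := hpp.two_le
      nlinarith [Nat.pos_of_ne_zero hd]
    rw [natDegree_sub_eq_left_of_natDegree_lt this, natDegree_pow]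
    exact dvd_mul_right _ _
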